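/- arXiv:1905.13604 — 6 statements merged into one kernel-verified Lean document; each statement's English description precedes it below -/
import Mathlib

section
/- (i) For every s ∈ ℝ there exists C > 0 such that ‖Ia‖_{U^s} ≤ C·‖a‖_{T^s} for every sequence a : ℕ → ℂ with ‖a‖_{T^s} < ∞. (ii) For every s ≥ 1 there exists C > 0 such that for every sequence a : ℕ → ℂ with ‖a‖_{U^s} < ∞, the series defining Ja converge absolutely and ‖Ja‖_{T^{s−1}} ≤ C·‖a‖_{U^s}. (These express the continuous inclusions T^s ⊂ U^s for all s, and U^s ⊂ T^{s−1} for s ≥ 1.) -/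
open scoped ENNReal NNReal

/-- The `T^s` norm of a Chebyshev coefficient sequence, valued in `[0,∞]`. -/
noncomputable def Tnorm (a : ℕ → ℂ) (s : ℝ) : ℝ≥0∞ :=
  ((‖a 0‖₊ : ℝ≥0∞) ^ 2
      + (1 / 2) * ∑' n : ℕ, ENNReal.ofReal ((1 + (n : ℝ) ^ 2) ^ s) * (‖a n‖₊ : ℝ≥0∞) ^ 2)
    ^ (1 / 2 : ℝ)

/-- The `U^s` norm of a Chebyshev coefficient sequence, valued in `[0,∞]`. -/
noncomputable def Unorm (a : ℕ → ℂ) (s : ℝ) : ℝ≥0∞ :=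
  ((1 / 2) * ∑' n : ℕ, ENNReal.ofReal ((1 + (n : ℝ) ^ 2) ^ s) * (‖a n‖₊ : ℝ≥0∞) ^ 2)
    ^ (1 / 2 : ℝ)

/-- The identification map `I` from first-kind to second-kind Chebyshev coefficients. -/
noncomputable def Imap (a : ℕ → ℂ) : ℕ → ℂ
  | 0 => a 0 - a 2 / 2
  | j + 1 => (a (j + 1) - a (j + 3)) / 2

/-- The identification map `J` from second-kind to first-kind Chebyshev coefficients. -/
noncomputable def Jmap (a : ℕ → ℂ) : ℕ → ℂ
  | 0 => ∑' n : ℕ, a (2 * n)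
  | j + 1 => 2 * ∑' n : ℕ, a (j + 1 + 2 * n)

/-- The Cauchy–Schwarz inequality for series in `[0,∞]`, with mutually inverse weights `p`, `q`. -/
theorem ENNReal.sq_tsum_le_tsum_mul_tsum {ι : Type*} (c p q : ι → ℝ≥0) (hpq : ∀ i, p i * q i = 1) :
    (∑' i, (c i : ℝ≥0∞)) ^ 2 ≤ (∑' i, (p i : ℝ≥0∞)) * ∑' i, (q i : ℝ≥0∞) * (c i : ℝ≥0∞) ^ 2 := by
  have key (k l : ι) : (2 : ℝ≥0∞) * (c k * c l) ≤
      p k * (q l * c l ^ 2) + p l * (q k * c k ^ 2) := by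
    norm_cast
    have hk : (p k : ℝ) * q k = 1 := by exact_mod_cast hpq k
    have hl : (p l : ℝ) * q l = 1 := by exact_mod_cast hpq l
    have h1 : (p k : ℝ) * (q l * c l ^ 2) * (p l * (q k * c k ^ 2)) = (c k * c l) ^ 2 := by
      linear_combination (p l * q l * c k ^ 2 * c l ^ 2 : ℝ) * hk + (c k ^ 2 * c l ^ 2 : ℝ) * hl
    rw [← NNReal.coe_le_coe]
    push_cast
    refine abs_le_of_sq_le_sq' ?_ (by positivity) |>.2
    nlinarith [sq_nonneg ((p k : ℝ) * (q l * c l ^ 2) - p l * (q k * c k ^ 2))]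
  have h2 : 2 * (∑' i, (c i : ℝ≥0∞)) ^ 2 ≤
      2 * ((∑' i, (p i : ℝ≥0∞)) * ∑' i, (q i : ℝ≥0∞) * (c i : ℝ≥0∞) ^ 2) := by
    calc 2 * (∑' i, (c i : ℝ≥0∞)) ^ 2 = ∑' k, ∑' l, (2 : ℝ≥0∞) * (c k * c l) := by
          simp only [sq, ENNReal.tsum_mul_left, ENNReal.tsum_mul_right]
      _ ≤ ∑' k, ∑' l, ((p k : ℝ≥0∞) * (q l * c l ^ 2) + p l * (q k * c k ^ 2)) :=
          ENNReal.tsum_le_tsum fun k => ENNReal.tsum_le_tsum fun l => key k l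
      _ = _ := by
          simp only [ENNReal.tsum_add, ENNReal.tsum_mul_left, ENNReal.tsum_mul_right]
          ring
  exact (ENNReal.mul_le_mul_iff_right (by simp) (by simp)).1 h2

theorem ENNReal.tsum_mul_tsum_add (f g : ℕ → ℝ≥0∞) :
    ∑' j, f j * ∑' k, g (j + k) = ∑' n, (∑ j ∈ Finset.range (n + 1), f j) * g n := by
  simp only [← ENNReal.tsum_mul_left]
  rw [← ENNReal.tsum_prod (f := fun j k => f j * g (j + k)),
    ← Finset.HasAntidiagonal.sigmaAntidiagonalEquivProd.tsum_eq, ENNReal.tsum_sigma']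
  refine tsum_congr fun n => ?_
  rw [tsum_fintype, Finset.sum_mul,
    ← Finset.Nat.sum_antidiagonal_eq_sum_range_succ (fun j _ => f j * g n),
    ← Finset.sum_coe_sort (Finset.HasAntidiagonal.antidiagonal n)]
  refine Finset.sum_congr rfl fun x _ => ?_
  simp [Finset.HasAntidiagonal.sigmaAntidiagonalEquivProd, Finset.HasAntidiagonal.mem_antidiagonal.1 x.2]

theorem ENNReal.tsum_ofReal_sub_le {u : ℕ → ℝ} (hu : Antitone u) (h0 : ∀ n, 0 ≤ u n) :
    ∑' n, ENNReal.ofReal (u n - u (n + 1)) ≤ ENNReal.ofReal (u 0) := by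
  refine ENNReal.tsum_le_of_sum_range_le fun n => ?_
  rw [← ENNReal.ofReal_sum_of_nonneg fun i _ => sub_nonneg.2 (hu i.le_succ),
    Finset.sum_range_sub']
  exact ENNReal.ofReal_le_ofReal (by linarith [h0 n])

theorem sum_range_inv_sqrt_le (n : ℕ) :
    ∑ j ∈ Finset.range n, 1 / √((j : ℝ) + 1) ≤ 2 * √(n : ℝ) := by
  induction n with
  | zero => simp
  | succ n ih =>
    rw [Finset.sum_range_succ]
    push_cast
    have h1 := Real.sq_sqrt (show (0 : ℝ) ≤ n by positivity)
    have h2 := Real.sq_sqrt (show (0 : ℝ) ≤ (n : ℝ) + 1 by positivity)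
    have h3 : 0 < √((n : ℝ) + 1) := by positivity
    have : 1 / √((n : ℝ) + 1) ≤ 2 * √((n : ℝ) + 1) - 2 * √(n : ℝ) := by
      rw [div_le_iff₀ h3]
      nlinarith [sq_nonneg (√((n : ℝ) + 1) - √(n : ℝ))]
    linarith

/-- The dual discrete Hardy inequality: tails of `c` are controlled in `ℓ²` by the weighted
`ℓ²` norm of `c`. -/
theorem tsum_sq_tsum_add_le (c : ℕ → ℝ≥0) :
    ∑' j, (∑' k, (c (j + k) : ℝ≥0∞)) ^ 2 ≤
      16 * ∑' n : ℕ, ENNReal.ofReal (1 + (n : ℝ) ^ 2) * (c n : ℝ≥0∞) ^ 2 := by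
  set u : ℕ → ℝ := fun n => 1 / √((n : ℝ) + 1) with hu
  have hanti : StrictAnti u := fun m n h => by
    have : (m : ℝ) < n := by exact_mod_cast h
    exact one_div_lt_one_div_of_lt (by positivity) (Real.sqrt_lt_sqrt (by positivity) (by linarith))
  have hu0 (n : ℕ) : 0 ≤ u n := by positivity
  have hd (n : ℕ) : 0 < u n - u (n + 1) := sub_pos.2 (hanti n.lt_succ_self)
  set p : ℕ → ℝ≥0 := fun n => (u n - u (n + 1)).toNNReal
  have hp (n : ℕ) : p n ≠ 0 := by simpa [p] using hanti n.lt_succ_self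
  have hpu (j : ℕ) : ∑' k, (p (j + k) : ℝ≥0∞) ≤ ENNReal.ofReal (u j) :=
    ENNReal.tsum_ofReal_sub_le (u := fun k => u (j + k))
      (fun m n h => hanti.antitone (by lia)) (fun n => hu0 _)
  have hw (n : ℕ) : (∑ j ∈ Finset.range (n + 1), ENNReal.ofReal (u j)) * ((p n)⁻¹ : ℝ≥0) ≤
      16 * ENNReal.ofReal (1 + (n : ℝ) ^ 2) := by
    have h16 : (16 : ℝ≥0∞) = ENNReal.ofReal 16 := by simp
    have hinv : (((p n)⁻¹ : ℝ≥0) : ℝ≥0∞) = ENNReal.ofReal (u n - u (n + 1))⁻¹ := by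
      rw [ENNReal.ofReal, Real.toNNReal_inv]
    rw [← ENNReal.ofReal_sum_of_nonneg fun i _ => hu0 i, hinv, h16,
      ← ENNReal.ofReal_mul (Finset.sum_nonneg fun i _ => hu0 i),
      ← ENNReal.ofReal_mul (by norm_num)]
    refine ENNReal.ofReal_le_ofReal ?_
    rw [← div_eq_mul_inv, div_le_iff₀ (hd n)]
    refine (sum_range_inv_sqrt_le (n + 1)).trans ?_
    simp only [hu]
    push_cast
    have h1 := Real.sq_sqrt (show (0 : ℝ) ≤ (n : ℝ) + 1 by positivity)
    have h2 := Real.sq_sqrt (show (0 : ℝ) ≤ (n : ℝ) + 1 + 1 by positivity)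
    have h3 : 0 < √((n : ℝ) + 1) := by positivity
    have h4 : 0 < √((n : ℝ) + 1 + 1) := by positivity
    have h5 : √((n : ℝ) + 1) ≤ √((n : ℝ) + 1 + 1) := Real.sqrt_le_sqrt (by linarith)
    have hn : (0 : ℝ) ≤ n := by positivity
    set x := √((n : ℝ) + 1)
    set y := √((n : ℝ) + 1 + 1)
    have h6 : 1 / x - 1 / y = 1 / (x * y * (x + y)) := by
      field_simp
      linarith
    rw [h6, mul_one_div, le_div_iff₀ (by positivity)]
    have h7 : 2 * x * (x * y * (x + y)) ≤ 4 * (x ^ 2 * y ^ 2) := by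
      have : 0 ≤ 2 * x ^ 2 * y * (y - x) := mul_nonneg (by positivity) (by linarith)
      nlinarith
    rw [h1, h2] at h7
    nlinarith [sq_nonneg ((n : ℝ) - 1)]
  calc ∑' j, (∑' k, (c (j + k) : ℝ≥0∞)) ^ 2
      ≤ ∑' j, ENNReal.ofReal (u j) *
          ∑' k, (((p (j + k))⁻¹ : ℝ≥0) : ℝ≥0∞) * (c (j + k) : ℝ≥0∞) ^ 2 := by
        refine ENNReal.tsum_le_tsum fun j => ?_
        refine (ENNReal.sq_tsum_le_tsum_mul_tsum (fun k => c (j + k)) (fun k => p (j + k))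
          (fun k => (p (j + k))⁻¹) fun k => mul_inv_cancel₀ (hp _)).trans ?_
        gcongr
        exact hpu j
    _ = ∑' n, (∑ j ∈ Finset.range (n + 1), ENNReal.ofReal (u j)) *
          ((((p n)⁻¹ : ℝ≥0) : ℝ≥0∞) * (c n : ℝ≥0∞) ^ 2) :=
        ENNReal.tsum_mul_tsum_add _ fun n => (((p n)⁻¹ : ℝ≥0) : ℝ≥0∞) * (c n : ℝ≥0∞) ^ 2
    _ ≤ _ := by
        rw [← ENNReal.tsum_mul_left]
        refine ENNReal.tsum_le_tsum fun n => ?_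
        rw [← mul_assoc, ← mul_assoc]
        exact mul_le_mul_left (hw n) _

/-- The squared weighted `ℓ²` norm `∑ (1 + n²)^s |aₙ|²`. -/
noncomputable def sobolevSum (a : ℕ → ℂ) (s : ℝ) : ℝ≥0∞ :=
  ∑' n : ℕ, ENNReal.ofReal ((1 + (n : ℝ) ^ 2) ^ s) * (‖a n‖₊ : ℝ≥0∞) ^ 2

theorem ENNReal.rpow_half_le_ofReal_mul_rpow_half {x y : ℝ≥0∞} {C : ℝ}
    (h : x ≤ ENNReal.ofReal C ^ 2 * y) :
    x ^ (1 / 2 : ℝ) ≤ ENNReal.ofReal C * y ^ (1 / 2 : ℝ) := by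
  refine (ENNReal.rpow_le_rpow h (by norm_num)).trans_eq ?_
  rw [ENNReal.mul_rpow_of_nonneg _ _ (by norm_num), ← ENNReal.rpow_natCast, ← ENNReal.rpow_mul]
  norm_num

theorem nnnorm_sq_Imap_le (a : ℕ → ℂ) (j : ℕ) :
    (‖Imap a j‖₊ : ℝ≥0∞) ^ 2 ≤ 2 * ((‖a j‖₊ : ℝ≥0∞) ^ 2 + (‖a (j + 2)‖₊ : ℝ≥0∞) ^ 2) := by
  norm_cast
  rw [← NNReal.coe_le_coe]
  push_cast
  have h : ‖Imap a j‖ ≤ ‖a j‖ + ‖a (j + 2)‖ := by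
    cases j with
    | zero =>
      refine (norm_sub_le _ _).trans ?_
      rw [norm_div, Complex.norm_ofNat]
      linarith [norm_nonneg (a 2)]
    | succ j =>
      simp only [Imap]
      rw [norm_div, Complex.norm_ofNat]
      linarith [norm_sub_le (a (j + 1)) (a (j + 3)), norm_nonneg (a (j + 1) - a (j + 3))]
  nlinarith [norm_nonneg (Imap a j), sq_nonneg (‖a j‖ - ‖a (j + 2)‖)]

theorem one_add_sq_rpow_le (s x : ℝ) (hx : 0 ≤ x) :
    (1 + x ^ 2) ^ s ≤ 9 ^ |s| * (1 + (x + 2) ^ 2) ^ s := by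
  rcases le_total 0 s with hs | hs
  · calc (1 + x ^ 2) ^ s ≤ (1 + (x + 2) ^ 2) ^ s := by gcongr; linarith
      _ ≤ 9 ^ |s| * (1 + (x + 2) ^ 2) ^ s :=
        le_mul_of_one_le_left (by positivity) (Real.one_le_rpow (by norm_num) (abs_nonneg s))
  · have h : (9 * (1 + x ^ 2)) ^ s ≤ (1 + (x + 2) ^ 2) ^ s :=
      Real.rpow_le_rpow_of_nonpos (by positivity)
        (by nlinarith [sq_nonneg (x - 1)]) hs
    rw [Real.mul_rpow (by norm_num) (by positivity)] at h
    rw [abs_of_nonpos hs, Real.rpow_neg (by norm_num), ← div_eq_inv_mul,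
      le_div_iff₀' (by positivity)]
    exact h

theorem sobolevSum_Imap_le (a : ℕ → ℂ) (s : ℝ) :
    sobolevSum (Imap a) s ≤ ENNReal.ofReal (2 * (1 + 9 ^ |s|)) * sobolevSum a s := by
  set w : ℕ → ℝ≥0∞ := fun n => ENNReal.ofReal ((1 + (n : ℝ) ^ 2) ^ s)
  have hw (n : ℕ) : w n ≤ ENNReal.ofReal (9 ^ |s|) * w (n + 2) := by
    rw [← ENNReal.ofReal_mul (by positivity)]
    refine ENNReal.ofReal_le_ofReal ?_
    exact_mod_cast one_add_sq_rpow_le s n n.cast_nonneg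
  calc sobolevSum (Imap a) s
      ≤ ∑' n, (2 * (w n * (‖a n‖₊ : ℝ≥0∞) ^ 2) + 2 * (ENNReal.ofReal (9 ^ |s|) *
          (w (n + 2) * (‖a (n + 2)‖₊ : ℝ≥0∞) ^ 2))) := by
        refine ENNReal.tsum_le_tsum fun n => ?_
        refine (mul_le_mul_right (nnnorm_sq_Imap_le a n) (w n)).trans ?_
        rw [mul_left_comm, mul_add, mul_add, ← mul_assoc (ENNReal.ofReal _)]
        gcongr
        exact hw n
    _ = 2 * sobolevSum a s + 2 * (ENNReal.ofReal (9 ^ |s|) *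
          ∑' n, w (n + 2) * (‖a (n + 2)‖₊ : ℝ≥0∞) ^ 2) := by
        simp only [ENNReal.tsum_add, ENNReal.tsum_mul_left]
        rfl
    _ ≤ 2 * sobolevSum a s + 2 * (ENNReal.ofReal (9 ^ |s|) * sobolevSum a s) := by
        gcongr
        exact ENNReal.tsum_comp_le_tsum_of_injective (add_left_injective 2)
          fun n => w n * (‖a n‖₊ : ℝ≥0∞) ^ 2
    _ = _ := by
        rw [ENNReal.ofReal_mul (by norm_num), ENNReal.ofReal_add (by norm_num) (by positivity)]
        simp only [ENNReal.ofReal_ofNat, ENNReal.ofReal_one]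
        ring

theorem Unorm_Imap_le (a : ℕ → ℂ) (s : ℝ) :
    Unorm (Imap a) s ≤ ENNReal.ofReal (2 * (1 + 9 ^ |s|)) * Tnorm a s := by
  refine ENNReal.rpow_half_le_ofReal_mul_rpow_half ?_
  have hC : 1 ≤ ENNReal.ofReal (2 * (1 + 9 ^ |s|)) := by
    rw [ENNReal.one_le_ofReal]
    linarith [Real.rpow_pos_of_pos (show (0 : ℝ) < 9 by norm_num) |s|]
  set K := ENNReal.ofReal (2 * (1 + 9 ^ |s|)) with hK
  calc 1 / 2 * sobolevSum (Imap a) s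
      ≤ 1 / 2 * (K * sobolevSum a s) := by gcongr; exact sobolevSum_Imap_le a s
    _ = K * (1 / 2 * sobolevSum a s) := mul_left_comm _ _ _
    _ ≤ K ^ 2 * ((‖a 0‖₊ : ℝ≥0∞) ^ 2 + 1 / 2 * sobolevSum a s) :=
        mul_le_mul' (le_self_pow₀ hC two_ne_zero) le_add_self

theorem tsum_weight_mul_sq_tail_le (a : ℕ → ℂ) {s : ℝ} (hs : 1 ≤ s) :
    ∑' j : ℕ, ENNReal.ofReal ((1 + (j : ℝ) ^ 2) ^ (s - 1)) *
      (∑' k, (‖a (j + k)‖₊ : ℝ≥0∞)) ^ 2 ≤ 16 * sobolevSum a s := by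
  set v : ℕ → ℝ≥0 := fun n => ((1 + (n : ℝ) ^ 2) ^ ((s - 1) / 2)).toNNReal
  have hv (n : ℕ) : (v n : ℝ≥0∞) ^ 2 = ENNReal.ofReal ((1 + (n : ℝ) ^ 2) ^ (s - 1)) := by
    change ENNReal.ofReal _ ^ 2 = _
    rw [← ENNReal.ofReal_pow (by positivity), ← Real.rpow_natCast, ← Real.rpow_mul (by positivity)]
    norm_num
  have hmono : Monotone v := fun m n h => by
    refine Real.toNNReal_le_toNNReal (Real.rpow_le_rpow (by positivity) ?_ (by linarith))
    gcongr
  refine le_trans ?_ ((tsum_sq_tsum_add_le fun n => v n * ‖a n‖₊).trans_eq ?_)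
  · refine ENNReal.tsum_le_tsum fun j => ?_
    rw [← hv, ← mul_pow, ← ENNReal.tsum_mul_left]
    gcongr with k
    rw [ENNReal.coe_mul]
    gcongr
    exact hmono (Nat.le_add_right j k)
  · congr 1
    refine tsum_congr fun n => ?_
    rw [ENNReal.coe_mul, mul_pow, hv, ← mul_assoc, ← ENNReal.ofReal_mul (by positivity),
      ← Real.rpow_one_add' (by positivity) (by linarith)]
    congr 4
    ring

theorem tail_ne_top {a : ℕ → ℂ} {s : ℝ} (hs : 1 ≤ s) (ha : sobolevSum a s ≠ ⊤) :
    ∑' k, (‖a k‖₊ : ℝ≥0∞) ≠ ⊤ := by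
  have h := (ENNReal.le_tsum 0).trans (tsum_weight_mul_sq_tail_le a hs)
  have h' := ne_top_of_le_ne_top (ENNReal.mul_ne_top (by simp) ha) h
  simpa using h'

theorem summable_norm_of_sobolevSum_ne_top {a : ℕ → ℂ} {s : ℝ} (hs : 1 ≤ s)
    (ha : sobolevSum a s ≠ ⊤) : Summable fun n => ‖a n‖ :=
  NNReal.summable_coe.2 (ENNReal.tsum_coe_ne_top_iff_summable.1 (tail_ne_top hs ha))

theorem nnnorm_tsum_comp_two_mul_le (a : ℕ → ℂ) (j : ℕ) :
    (‖∑' n, a (j + 2 * n)‖₊ : ℝ≥0∞) ≤ ∑' k, (‖a (j + k)‖₊ : ℝ≥0∞) :=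
  (enorm_tsum_le_tsum_enorm (f := fun n => a (j + 2 * n))).trans <|
    ENNReal.tsum_comp_le_tsum_of_injective (f := fun n => 2 * n)
      (mul_right_injective₀ two_ne_zero) fun k => (‖a (j + k)‖₊ : ℝ≥0∞)

theorem nnnorm_Jmap_le (a : ℕ → ℂ) (j : ℕ) :
    (‖Jmap a j‖₊ : ℝ≥0∞) ≤ 2 * ∑' k, (‖a (j + k)‖₊ : ℝ≥0∞) := by
  have h := nnnorm_tsum_comp_two_mul_le a j
  cases j with
  | zero =>
    simp only [zero_add] at h ⊢
    exact h.trans (le_mul_of_one_le_left' one_le_two)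
  | succ j =>
    simp only [Jmap, nnnorm_mul, ENNReal.coe_mul]
    gcongr
    simp

theorem sobolevSum_Jmap_le (a : ℕ → ℂ) {s : ℝ} (hs : 1 ≤ s) :
    sobolevSum (Jmap a) (s - 1) ≤ 64 * sobolevSum a s := by
  calc sobolevSum (Jmap a) (s - 1)
      ≤ ∑' j : ℕ, 4 * (ENNReal.ofReal ((1 + (j : ℝ) ^ 2) ^ (s - 1)) *
          (∑' k, (‖a (j + k)‖₊ : ℝ≥0∞)) ^ 2) := by
        refine ENNReal.tsum_le_tsum fun j => ?_
        refine (mul_le_mul_right (pow_le_pow_left' (nnnorm_Jmap_le a j) 2) _).trans_eq ?_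
        ring
    _ ≤ 4 * (16 * sobolevSum a s) := by
        rw [ENNReal.tsum_mul_left]
        gcongr
        exact tsum_weight_mul_sq_tail_le a hs
    _ = 64 * sobolevSum a s := by ring

theorem Tnorm_Jmap_le (a : ℕ → ℂ) {s : ℝ} (hs : 1 ≤ s) :
    Tnorm (Jmap a) (s - 1) ≤ ENNReal.ofReal 16 * Unorm a s := by
  refine ENNReal.rpow_half_le_ofReal_mul_rpow_half ?_
  have h0 : (‖Jmap a 0‖₊ : ℝ≥0∞) ^ 2 ≤ sobolevSum (Jmap a) (s - 1) := by
    refine le_trans ?_ (ENNReal.le_tsum 0)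
    simp
  have h2 : (1 / 2 : ℝ≥0∞) ≤ 1 := by simp
  have h3 : (2 : ℝ≥0∞) * (1 / 2) = 1 := by
    rw [one_div, ENNReal.mul_inv_cancel two_ne_zero (by simp)]
  calc (‖Jmap a 0‖₊ : ℝ≥0∞) ^ 2 + 1 / 2 * sobolevSum (Jmap a) (s - 1)
      ≤ sobolevSum (Jmap a) (s - 1) + 1 * sobolevSum (Jmap a) (s - 1) := by gcongr
    _ = 2 * sobolevSum (Jmap a) (s - 1) := by rw [one_mul, two_mul]
    _ ≤ 2 * (64 * sobolevSum a s) := by gcongr; exact sobolevSum_Jmap_le a hs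
    _ = 128 * ((2 * (1 / 2)) * sobolevSum a s) := by rw [h3]; ring
    _ = ENNReal.ofReal 16 ^ 2 * (1 / 2 * sobolevSum a s) := by
        rw [ENNReal.ofReal_ofNat]
        ring

/-- (i) `T^s ⊂ U^s` continuously for all `s`; (ii) `U^s ⊂ T^{s-1}` continuously for `s ≥ 1`. -/
theorem stmt2 :
    (∀ s : ℝ, ∃ C : ℝ, 0 < C ∧ ∀ a : ℕ → ℂ, Tnorm a s ≠ ⊤ →
        Unorm (Imap a) s ≤ ENNReal.ofReal C * Tnorm a s) ∧
      (∀ s : ℝ, 1 ≤ s → ∃ C : ℝ, 0 < C ∧ ∀ a : ℕ → ℂ, Unorm a s ≠ ⊤ →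
        (∀ j : ℕ, Summable fun n : ℕ => ‖a (j + 2 * n)‖) ∧
          Tnorm (Jmap a) (s - 1) ≤ ENNReal.ofReal C * Unorm a s) := by
  refine ⟨fun s => ⟨2 * (1 + 9 ^ |s|), by positivity, fun a _ => Unorm_Imap_le a s⟩,
    fun s hs => ⟨16, by norm_num, fun a ha => ⟨fun j => ?_, Tnorm_Jmap_le a hs⟩⟩⟩
  have hN : sobolevSum a s ≠ ⊤ := fun h => ha <| by
    change (1 / 2 * sobolevSum a s) ^ (1 / 2 : ℝ) = ⊤
    simp [h]
  exact (summable_norm_of_sobolevSum_ne_top hs hN).comp_injective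
    (i := fun n => j + 2 * n) fun m n h => by simpa using h
end

section
/- For every s > 1/2 and every σ < s − 1 there exists C > 0 such that for every sequence a : ℕ → ℂ with ‖a‖_{U^s} < ∞, the series defining Ja converge absolutely and ‖Ja‖_{T^σ} ≤ C·‖a‖_{U^s}. (This expresses the continuous inclusion U^s ⊂ T^{s−1−ε} for every ε > 0 when s > 1/2.) -/
open scoped ENNReal NNReal

/-- Cauchy–Schwarz for series in `[0,∞]`. -/
theorem ENNReal.tsum_mul_sq_le (f g : ℕ → ℝ≥0∞) :
    (∑' n, f n * g n) ^ 2 ≤ (∑' n, f n ^ 2) * ∑' n, g n ^ 2 := by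
  have h := ENNReal.lintegral_mul_le_Lp_mul_Lq (MeasureTheory.Measure.count (α := ℕ))
    Real.HolderConjugate.two_two
    (measurable_of_countable f).aemeasurable (measurable_of_countable g).aemeasurable
  simp only [MeasureTheory.lintegral_count, Pi.mul_apply, ENNReal.rpow_two] at h
  calc (∑' n, f n * g n) ^ 2
      ≤ ((∑' n, f n ^ 2) ^ (1 / 2 : ℝ) * (∑' n, g n ^ 2) ^ (1 / 2 : ℝ)) ^ 2 := by gcongr
    _ = (∑' n, f n ^ 2) * ∑' n, g n ^ 2 := by
      rw [← ENNReal.mul_rpow_of_nonneg _ _ (by norm_num), ← ENNReal.rpow_two, ← ENNReal.rpow_mul]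
      norm_num

/-- The Sobolev weight `(1 + n²)^r`, valued in `[0,∞]`. -/
noncomputable def sobolevWeight (r : ℝ) (n : ℕ) : ℝ≥0∞ :=
  ENNReal.ofReal ((1 + (n : ℝ) ^ 2) ^ r)

theorem sobolevWeight_add (r t : ℝ) (n : ℕ) :
    sobolevWeight (r + t) n = sobolevWeight r n * sobolevWeight t n := by
  rw [sobolevWeight, Real.rpow_add (by positivity), ENNReal.ofReal_mul (by positivity)]
  rfl

theorem sobolevWeight_zero_exponent (n : ℕ) : sobolevWeight 0 n = 1 := by
  simp [sobolevWeight]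

theorem sobolevWeight_zero (r : ℝ) : sobolevWeight r 0 = 1 := by
  simp [sobolevWeight]

theorem sobolevWeight_half_sq (r : ℝ) (n : ℕ) : sobolevWeight (r / 2) n ^ 2 = sobolevWeight r n := by
  rw [sq, ← sobolevWeight_add, add_halves]

theorem sobolevWeight_antitone {r : ℝ} (hr : r ≤ 0) : Antitone (sobolevWeight r) := by
  intro m n hmn
  refine ENNReal.ofReal_le_ofReal (Real.rpow_le_rpow_of_nonpos (by positivity) ?_ hr)
  gcongr

theorem tsum_sobolevWeight_ne_top {r : ℝ} (hr : r < -1 / 2) : ∑' n, sobolevWeight r n ≠ ⊤ := by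
  refine Summable.tsum_ofReal_ne_top ?_
  refine (summable_nat_add_iff 1).1 (Summable.of_nonneg_of_le (fun n => by positivity) ?_
    ((summable_nat_add_iff 1).2 (Real.summable_nat_rpow.2 (show 2 * r < -1 by linarith))))
  intro n
  rw [Real.rpow_mul (by positivity), Real.rpow_two]
  refine Real.rpow_le_rpow_of_nonpos (by positivity) ?_ (by linarith)
  linarith

/-- The tails `∑ |a_{j+2n}|` are controlled by the weighted `ℓ²` norm of `a`. -/
theorem tsum_enorm_tail_sq_le (a : ℕ → ℂ) {s t : ℝ} (hts : t ≤ s) (j : ℕ) :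
    (∑' n, ‖a (j + 2 * n)‖ₑ) ^ 2 ≤
      sobolevWeight (t - s) j * (∑' n, sobolevWeight (-t) n) *
        ∑' n, sobolevWeight s n * ‖a n‖ₑ ^ 2 := by
  have hinj : Function.Injective fun n : ℕ => j + 2 * n := fun m n h => by
    simp only at h; omega
  calc (∑' n, ‖a (j + 2 * n)‖ₑ) ^ 2
      = (∑' n, sobolevWeight (-s / 2) (j + 2 * n) *
          (sobolevWeight (s / 2) (j + 2 * n) * ‖a (j + 2 * n)‖ₑ)) ^ 2 := by
        congr 2 with n
        rw [← mul_assoc, ← sobolevWeight_add, show -s / 2 + s / 2 = 0 by ring,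
          sobolevWeight_zero_exponent, one_mul]
    _ ≤ (∑' n, sobolevWeight (-s) (j + 2 * n)) *
          ∑' n, sobolevWeight s (j + 2 * n) * ‖a (j + 2 * n)‖ₑ ^ 2 := by
        refine (ENNReal.tsum_mul_sq_le _ _).trans_eq ?_
        simp only [mul_pow, sobolevWeight_half_sq]
    _ ≤ _ := by
        gcongr ?_ * ?_
        · calc ∑' n, sobolevWeight (-s) (j + 2 * n)
              ≤ ∑' n, sobolevWeight (t - s) j * sobolevWeight (-t) (j + 2 * n) := by
                refine ENNReal.tsum_le_tsum fun n => ?_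
                rw [show -s = (t - s) + -t by ring, sobolevWeight_add]
                gcongr
                exact sobolevWeight_antitone (by linarith) (by omega)
            _ ≤ _ := by
                rw [ENNReal.tsum_mul_left]
                gcongr _ * ?_
                exact ENNReal.tsum_comp_le_tsum_of_injective hinj (sobolevWeight (-t))
        · exact ENNReal.tsum_comp_le_tsum_of_injective hinj
            fun n => sobolevWeight s n * ‖a n‖ₑ ^ 2

theorem enorm_Jmap_le (a : ℕ → ℂ) (j : ℕ) : ‖Jmap a j‖ₑ ≤ 2 * ∑' n, ‖a (j + 2 * n)‖ₑ := by
  cases j with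
  | zero =>
    simp only [Jmap, Nat.zero_add]
    exact enorm_tsum_le_tsum_enorm.trans (le_mul_of_one_le_left' one_le_two)
  | succ j =>
    simp only [Jmap, enorm_mul]
    gcongr
    · simp [enorm_eq_nnnorm]
    · exact enorm_tsum_le_tsum_enorm

/-- For `s > 1/2`, `U^s ⊂ T^σ` continuously for every `σ < s - 1`. -/
theorem stmt3 (s σ : ℝ) (hs : 1 / 2 < s) (hσ : σ < s - 1) :
    ∃ C : ℝ, 0 < C ∧ ∀ a : ℕ → ℂ, Unorm a s ≠ ⊤ →
      (∀ j : ℕ, Summable fun n : ℕ => ‖a (j + 2 * n)‖) ∧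
        Tnorm (Jmap a) σ ≤ ENNReal.ofReal C * Unorm a s := by
  obtain ⟨t, ht, hts, htσ⟩ : ∃ t : ℝ, 1 / 2 < t ∧ t ≤ s ∧ σ + (t - s) < -1 / 2 := by
    refine ⟨min s ((s - σ) / 2), lt_min hs (by linarith), min_le_left _ _, ?_⟩
    linarith [min_le_right s ((s - σ) / 2)]
  set K := ∑' n, sobolevWeight (-t) n
  set L := ∑' n, sobolevWeight (σ + (t - s)) n
  have hK : K ≠ ⊤ := tsum_sobolevWeight_ne_top (by linarith)
  have hL : L ≠ ⊤ := tsum_sobolevWeight_ne_top htσ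
  set M := 4 * K * (2 + L) + 1
  have hM : M ≠ ⊤ := by finiteness
  have hM' : M ^ (1 / 2 : ℝ) ≠ ⊤ := ENNReal.rpow_ne_top_of_nonneg (by norm_num) hM
  refine ⟨(M ^ (1 / 2 : ℝ)).toReal, ENNReal.toReal_pos ?_ hM', fun a ha => ?_⟩
  · exact (ENNReal.rpow_pos (by simp [M]) hM).ne'
  set A := ∑' n, sobolevWeight s n * ‖a n‖ₑ ^ 2
  have hU : Unorm a s = (1 / 2 * A) ^ (1 / 2 : ℝ) := rfl
  have hA : A ≠ ⊤ := by
    rintro hA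
    rw [hU, hA, ENNReal.mul_top (by simp), ENNReal.top_rpow_of_pos (by norm_num)] at ha
    exact ha rfl
  have htail (j : ℕ) := tsum_enorm_tail_sq_le a hts j
  constructor
  · intro j
    rw [← tsum_enorm_ne_top_iff_summable_norm]
    intro h
    have hj := htail j
    rw [h, ENNReal.top_pow two_ne_zero, top_le_iff] at hj
    exact ENNReal.mul_ne_top (ENNReal.mul_ne_top ENNReal.ofReal_ne_top hK) hA hj
  · have hJ (j : ℕ) : ‖Jmap a j‖ₑ ^ 2 ≤ 4 * (sobolevWeight (t - s) j * K * A) :=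
      calc ‖Jmap a j‖ₑ ^ 2 ≤ (2 * ∑' n, ‖a (j + 2 * n)‖ₑ) ^ 2 := by
            gcongr; exact enorm_Jmap_le a j
        _ = 4 * (∑' n, ‖a (j + 2 * n)‖ₑ) ^ 2 := by rw [mul_pow]; norm_num
        _ ≤ _ := by gcongr; exact htail j
    have hsum : ∑' n, sobolevWeight σ n * ‖Jmap a n‖ₑ ^ 2 ≤ L * (4 * K * A) := by
      rw [← ENNReal.tsum_mul_right]
      refine ENNReal.tsum_le_tsum fun n => ?_
      calc sobolevWeight σ n * ‖Jmap a n‖ₑ ^ 2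
          ≤ sobolevWeight σ n * (4 * (sobolevWeight (t - s) n * K * A)) := by
            gcongr; exact hJ n
        _ = _ := by rw [sobolevWeight_add]; ring
    have h0 : ‖Jmap a 0‖ₑ ^ 2 ≤ 4 * K * A := by
      simpa [sobolevWeight_zero, mul_assoc] using hJ 0
    rw [ENNReal.ofReal_toReal hM', hU, ← ENNReal.mul_rpow_of_nonneg _ _ (by norm_num)]
    refine ENNReal.rpow_le_rpow ?_ (by norm_num)
    calc ‖Jmap a 0‖ₑ ^ 2 + 1 / 2 * ∑' n, sobolevWeight σ n * ‖Jmap a n‖ₑ ^ 2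
        ≤ 4 * K * A + 1 / 2 * (L * (4 * K * A)) := by gcongr
      _ = (2 * (1 / 2)) * (4 * K * A) + 1 / 2 * (L * (4 * K * A)) := by
        rw [one_div, ENNReal.mul_inv_cancel two_ne_zero ENNReal.ofNat_ne_top, one_mul]
      _ = 4 * K * (2 + L) * (1 / 2 * A) := by ring
      _ ≤ M * (1 / 2 * A) := by gcongr; exact le_self_add
end

section
/- For every s ∈ ℝ there is no constant C > 0 such that ‖Ja‖_{T^s} ≤ C·‖a‖_{U^{1/2}} holds for all finitely supported sequences a : ℕ → ℝ with nonnegative entries; that is, for every s ∈ ℝ and every C > 0 there exists a finitely supported a with ‖Ja‖_{T^s} > C·‖a‖_{U^{1/2}}. (This expresses that U^{1/2} is not continuously embedded in T^s for any s.) -/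
open scoped ENNReal NNReal

/-- The harmonic weights `1 / (n + 1)`, `n < N`, placed at the even indices `2 * n`. -/
noncomputable def evenHarmonic (N k : ℕ) : ℝ :=
  if Even k ∧ k < 2 * N then 1 / ((k : ℝ) / 2 + 1) else 0

theorem evenHarmonic_two_mul (N n : ℕ) :
    evenHarmonic N (2 * n) = if n < N then 1 / ((n : ℝ) + 1) else 0 := by
  simp [evenHarmonic]

theorem evenHarmonic_nonneg (N k : ℕ) : 0 ≤ evenHarmonic N k := by
  unfold evenHarmonic
  split_ifs <;> positivity

theorem finite_support_evenHarmonic (N : ℕ) : (Function.support (evenHarmonic N)).Finite := by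
  refine (Set.finite_lt_nat (2 * N)).subset fun k hk => ?_
  by_contra h
  exact hk (ite_cond_eq_false _ _ (by simp at h ⊢; omega))

theorem nnnorm_ofReal_eq_ennreal_ofReal {x : ℝ} (hx : 0 ≤ x) :
    (‖(x : ℂ)‖₊ : ℝ≥0∞) = ENNReal.ofReal x := by
  rw [← enorm_eq_nnnorm, ← ofReal_norm, Complex.norm_real, Real.norm_of_nonneg hx]

theorem Jmap_evenHarmonic_zero (N : ℕ) :
    Jmap (fun n => (evenHarmonic N n : ℂ)) 0
      = ((∑ n ∈ Finset.range N, 1 / ((n : ℝ) + 1) : ℝ) : ℂ) := by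
  have h : ∑' n : ℕ, evenHarmonic N (2 * n) = ∑ n ∈ Finset.range N, 1 / ((n : ℝ) + 1) := by
    rw [tsum_eq_sum (s := Finset.range N)]
    · exact Finset.sum_congr rfl fun n hn => by
        rw [evenHarmonic_two_mul, if_pos (Finset.mem_range.1 hn)]
    · intro n hn
      rw [evenHarmonic_two_mul, if_neg (by simpa using hn)]
  rw [← h, Complex.ofReal_tsum]
  rfl

theorem weight_mul_sq_le (n : ℕ) :
    (1 + ((2 * n : ℕ) : ℝ) ^ 2) ^ (1 / 2 : ℝ) * (1 / ((n : ℝ) + 1)) ^ 2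
      ≤ 2 * (1 / ((n : ℝ) + 1)) := by
  have hw : (1 + ((2 * n : ℕ) : ℝ) ^ 2) ^ (1 / 2 : ℝ) ≤ 2 * ((n : ℝ) + 1) := by
    rw [← Real.sqrt_eq_rpow]
    refine Real.sqrt_le_iff.2 ⟨by positivity, ?_⟩
    push_cast
    nlinarith [(Nat.cast_nonneg n : (0 : ℝ) ≤ n)]
  calc _ ≤ 2 * ((n : ℝ) + 1) * (1 / ((n : ℝ) + 1)) ^ 2 := by gcongr
    _ = 2 * (1 / ((n : ℝ) + 1)) := by field_simp

theorem Unorm_evenHarmonic_le (N : ℕ) :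
    Unorm (fun n => (evenHarmonic N n : ℂ)) (1 / 2)
      ≤ ENNReal.ofReal √(∑ n ∈ Finset.range N, 1 / ((n : ℝ) + 1)) := by
  have hH : 0 ≤ ∑ n ∈ Finset.range N, 1 / ((n : ℝ) + 1) :=
    Finset.sum_nonneg fun n _ => by positivity
  rw [Real.sqrt_eq_rpow, ← ENNReal.ofReal_rpow_of_nonneg hH (by norm_num)]
  refine ENNReal.rpow_le_rpow ?_ (by norm_num)
  have hinj : Function.Injective fun n : ℕ => 2 * n := fun a b h => by simpa using h
  rw [← hinj.tsum_eq, tsum_eq_sum (s := Finset.range N)]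
  · calc _ ≤ 1 / 2 * ∑ n ∈ Finset.range N, ENNReal.ofReal (2 * (1 / ((n : ℝ) + 1))) := by
          gcongr with n hn
          rw [nnnorm_ofReal_eq_ennreal_ofReal (evenHarmonic_nonneg _ _), evenHarmonic_two_mul,
            if_pos (Finset.mem_range.1 hn), ← ENNReal.ofReal_pow (by positivity),
            ← ENNReal.ofReal_mul (by positivity)]
          exact ENNReal.ofReal_le_ofReal (weight_mul_sq_le n)
      _ = _ := by
          rw [← ENNReal.ofReal_sum_of_nonneg fun n _ => by positivity, ← Finset.mul_sum,
            ENNReal.ofReal_mul (by norm_num), ← mul_assoc, ENNReal.ofReal_ofNat, one_div,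
            ENNReal.inv_mul_cancel (by norm_num) (by norm_num), one_mul]
  · intro n hn
    simp [evenHarmonic_two_mul, if_neg (show ¬ n < N by simpa using hn)]
  · intro k hk
    by_contra h
    refine hk ?_
    have hk' : ¬ Even k := fun he => h (by
      obtain ⟨m, hm⟩ := he.two_dvd
      exact ⟨m, hm.symm⟩)
    simp [evenHarmonic, hk']

theorem nnnorm_zero_le_Tnorm (a : ℕ → ℂ) (s : ℝ) : (‖a 0‖₊ : ℝ≥0∞) ≤ Tnorm a s := by
  calc (‖a 0‖₊ : ℝ≥0∞) = ((‖a 0‖₊ : ℝ≥0∞) ^ 2) ^ (1 / 2 : ℝ) := by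
        rw [← ENNReal.rpow_natCast, ← ENNReal.rpow_mul]
        norm_num
    _ ≤ Tnorm a s := ENNReal.rpow_le_rpow le_self_add (by norm_num)

/-- `U^{1/2}` is not continuously embedded in `T^s` for any `s`. -/
theorem stmt4 (s : ℝ) (C : ℝ) (hC : 0 < C) :
    ∃ a : ℕ → ℝ, (Function.support a).Finite ∧ (∀ n, 0 ≤ a n) ∧
      ENNReal.ofReal C * Unorm (fun n => (a n : ℂ)) (1 / 2)
        < Tnorm (Jmap fun n => (a n : ℂ)) s := by
  obtain ⟨N, hN⟩ :=
    (Real.tendsto_sum_range_one_div_nat_succ_atTop.eventually_gt_atTop (C ^ 2)).exists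
  refine ⟨evenHarmonic N, finite_support_evenHarmonic N, evenHarmonic_nonneg N, ?_⟩
  refine lt_of_lt_of_le ?_ (nnnorm_zero_le_Tnorm _ _)
  have hH : 0 < ∑ n ∈ Finset.range N, 1 / ((n : ℝ) + 1) := lt_trans (by positivity) hN
  rw [Jmap_evenHarmonic_zero, nnnorm_ofReal_eq_ennreal_ofReal hH.le]
  refine lt_of_le_of_lt (mul_le_mul_right (Unorm_evenHarmonic_le N) _) ?_
  rw [← ENNReal.ofReal_mul hC.le, ENNReal.ofReal_lt_ofReal_iff hH]
  calc _ < √(∑ n ∈ Finset.range N, 1 / ((n : ℝ) + 1)) *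
        √(∑ n ∈ Finset.range N, 1 / ((n : ℝ) + 1)) :=
        mul_lt_mul_of_pos_right (Real.lt_sqrt_of_sq_lt hN) (Real.sqrt_pos.2 hH)
    _ = _ := Real.mul_self_sqrt hH.le
end

section
/- Let u : ℝ → ℝ be infinitely differentiable on a neighborhood of [−1,1]. Then its first-kind Chebyshev coefficients are rapidly decreasing: for every k ∈ ℕ there exists C > 0 such that for all n ≥ 1, |(1/π)·∫_{−1}^{1} u(x)·Tₙ(x)·(1−x²)^{−1/2} dx| ≤ C·n^{−k}. -/
open MeasureTheory Real

/-- The degree-`n` Chebyshev polynomial of the first kind, as a function `ℝ → ℝ`. -/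
noncomputable def chebT (n : ℕ) (x : ℝ) : ℝ :=
  (Polynomial.Chebyshev.T ℝ (n : ℤ)).eval x

/-- The weighted integral of `u * Tₙ` is a cosine integral, by the substitution `x = cos θ`. -/
theorem integral_mul_chebT (u : ℝ → ℝ) (n : ℕ) :
    ∫ x in Set.Ioo (-1 : ℝ) 1, u x * chebT n x * (Real.sqrt (1 - x ^ 2))⁻¹ =
      ∫ θ in 0..π, u (cos θ) * cos (n * θ) := by
  have h := Polynomial.Chebyshev.integral_measureT_eq_integral_cos (f := fun x ↦ u x * chebT n x)
  rw [Polynomial.Chebyshev.integral_measureT, intervalIntegral.integral_of_le (by norm_num),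
    integral_Ioc_eq_integral_Ioo] at h
  simpa [Real.sqrt_inv, chebT] using h

/-- The Chebyshev operator `-((1 - x²) u'' - x u')`, of which `Tₙ` is an eigenfunction with
eigenvalue `n²`. -/
noncomputable def chebOp (u : ℝ → ℝ) (x : ℝ) : ℝ :=
  x * deriv u x - (1 - x ^ 2) * deriv (deriv u) x

theorem ContDiffOn.chebOp {u : ℝ → ℝ} {V : Set ℝ} (hu : ContDiffOn ℝ (⊤ : ℕ∞) u V)
    (hV : IsOpen V) : ContDiffOn ℝ (⊤ : ℕ∞) (chebOp u) V := by
  have h₁ : ContDiffOn ℝ (⊤ : ℕ∞) (deriv u) V := hu.deriv_of_isOpen hV (by simp)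
  have h₂ : ContDiffOn ℝ (⊤ : ℕ∞) (deriv (deriv u)) V := h₁.deriv_of_isOpen hV (by simp)
  unfold _root_.chebOp
  fun_prop

theorem continuous_comp_cos {u : ℝ → ℝ} {V : Set ℝ} (hIV : Set.Icc (-1 : ℝ) 1 ⊆ V)
    (hu : ContinuousOn u V) : Continuous fun θ ↦ u (cos θ) :=
  hu.comp_continuous continuous_cos fun θ ↦ hIV (cos_mem_Icc θ)

/-- Integrating by parts twice: the boundary terms vanish, and the Chebyshev operator appears. -/
theorem integral_comp_cos_mul_cos {u : ℝ → ℝ} {V : Set ℝ} (hV : IsOpen V)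
    (hIV : Set.Icc (-1 : ℝ) 1 ⊆ V) (hu : ContDiffOn ℝ (⊤ : ℕ∞) u V) {n : ℕ} (hn : 1 ≤ n) :
    ∫ θ in 0..π, u (cos θ) * cos (n * θ) =
      (∫ θ in 0..π, chebOp u (cos θ) * cos (n * θ)) / (n : ℝ) ^ 2 := by
  have hn0 : (n : ℝ) ≠ 0 := by positivity
  have h₁ : ContDiffOn ℝ (⊤ : ℕ∞) (deriv u) V := hu.deriv_of_isOpen hV (by simp)
  have hderiv {f : ℝ → ℝ} (hf : ContDiffOn ℝ (⊤ : ℕ∞) f V) (θ : ℝ) :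
      HasDerivAt (fun θ ↦ f (cos θ)) (deriv f (cos θ) * -sin θ) θ :=
    ((hf.differentiableOn (by simp)).differentiableAt
      (hV.mem_nhds (hIV (cos_mem_Icc θ)))).hasDerivAt.comp θ (hasDerivAt_cos θ)
  have hc₁ := continuous_comp_cos hIV h₁.continuousOn
  have hcL := continuous_comp_cos hIV (hu.chebOp hV).continuousOn
  have hlin (θ : ℝ) : HasDerivAt (fun θ : ℝ ↦ n * θ) n θ := by
    simpa using (hasDerivAt_id θ).const_mul (n : ℝ)
  have hsin (θ : ℝ) : HasDerivAt (fun θ ↦ sin (n * θ) / n) (cos (n * θ)) θ := by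
    refine ((hlin θ).sin.div_const (n : ℝ)).congr_deriv ?_
    field_simp
  have hcos (θ : ℝ) : HasDerivAt (fun θ ↦ -cos (n * θ) / n) (sin (n * θ)) θ := by
    refine ((hlin θ).cos.neg.div_const (n : ℝ)).congr_deriv ?_
    field_simp
  have hw (θ : ℝ) : HasDerivAt (fun θ ↦ deriv u (cos θ) * sin θ) (chebOp u (cos θ)) θ := by
    refine ((hderiv h₁ θ).mul (hasDerivAt_sin θ)).congr_deriv ?_
    rw [chebOp, ← sin_sq]
    ring
  have e₁ := intervalIntegral.integral_mul_deriv_eq_deriv_mul (a := 0) (b := π)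
    (fun θ _ ↦ hderiv hu θ) (fun θ _ ↦ hsin θ)
    (Continuous.intervalIntegrable (by fun_prop) _ _)
    (Continuous.intervalIntegrable (by fun_prop) _ _)
  have e₂ := intervalIntegral.integral_mul_deriv_eq_deriv_mul (a := 0) (b := π)
    (fun θ _ ↦ hw θ) (fun θ _ ↦ hcos θ)
    (Continuous.intervalIntegrable (by fun_prop) _ _)
    (Continuous.intervalIntegrable (by fun_prop) _ _)
  have e₃ : ∫ θ in 0..π, deriv u (cos θ) * -sin θ * (sin (n * θ) / n) =
      -(∫ θ in 0..π, deriv u (cos θ) * sin θ * sin (n * θ)) / n := by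
    rw [← intervalIntegral.integral_neg, ← intervalIntegral.integral_div]
    congr 1 with θ
    ring
  have e₄ : ∫ θ in 0..π, chebOp u (cos θ) * (-cos (n * θ) / n) =
      -(∫ θ in 0..π, chebOp u (cos θ) * cos (n * θ)) / n := by
    rw [← intervalIntegral.integral_neg, ← intervalIntegral.integral_div]
    congr 1 with θ
    ring
  rw [e₁, e₃, e₂, e₄]
  simp only [sin_nat_mul_pi, sin_pi, sin_zero, mul_zero, zero_div, zero_mul]
  field_simp
  ring

theorem exists_abs_integral_comp_cos_mul_cos_le {V : Set ℝ} (hV : IsOpen V)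
    (hIV : Set.Icc (-1 : ℝ) 1 ⊆ V) (k : ℕ) {u : ℝ → ℝ} (hu : ContDiffOn ℝ (⊤ : ℕ∞) u V) :
    ∃ C : ℝ, 0 < C ∧ ∀ n : ℕ, 1 ≤ n →
      |∫ θ in 0..π, u (cos θ) * cos (n * θ)| ≤ C / (n : ℝ) ^ k := by
  induction k generalizing u with
  | zero =>
    obtain ⟨M, hM⟩ := isCompact_Icc.exists_bound_of_continuousOn (hu.continuousOn.mono hIV)
    have hM0 : 0 ≤ M := (norm_nonneg _).trans (hM 0 (by simp))
    refine ⟨M * π + 1, by positivity, fun n _ ↦ ?_⟩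
    have h := intervalIntegral.norm_integral_le_of_norm_le_const (a := 0) (b := π) (C := M)
      (f := fun θ ↦ u (cos θ) * cos (n * θ)) fun θ _ ↦ by
        rw [norm_mul]
        exact (mul_le_of_le_one_right (norm_nonneg _) (abs_cos_le_one _)).trans
          (hM _ (cos_mem_Icc θ))
    rw [sub_zero, abs_of_pos pi_pos, Real.norm_eq_abs] at h
    simpa using h.trans (le_add_of_nonneg_right zero_le_one)
  | succ k ih =>
    obtain ⟨C, hC, h⟩ := ih (hu.chebOp hV)
    refine ⟨C, hC, fun n hn ↦ ?_⟩
    have hn' : (1 : ℝ) ≤ n := by exact_mod_cast hn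
    rw [integral_comp_cos_mul_cos hV hIV hu hn, abs_div,
      abs_of_nonneg (by positivity : (0 : ℝ) ≤ n ^ 2)]
    calc _ ≤ C / (n : ℝ) ^ k / (n : ℝ) ^ 2 := by gcongr; exact h n hn
      _ = C / (n : ℝ) ^ (k + 2) := by rw [div_div, ← pow_add]
      _ ≤ C / (n : ℝ) ^ (k + 1) := by gcongr; simp

/-- A function smooth on a neighborhood of `[-1,1]` has rapidly decreasing
first-kind Chebyshev coefficients. -/
theorem stmt7 (u : ℝ → ℝ) (V : Set ℝ) (hV : IsOpen V) (hIV : Set.Icc (-1 : ℝ) 1 ⊆ V)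
    (hu : ContDiffOn ℝ (⊤ : ℕ∞) u V) :
    ∀ k : ℕ, ∃ C : ℝ, 0 < C ∧ ∀ n : ℕ, 1 ≤ n →
      |(1 / π) * ∫ x in Set.Ioo (-1 : ℝ) 1, u x * chebT n x * (Real.sqrt (1 - x ^ 2))⁻¹|
        ≤ C / (n : ℝ) ^ k := by
  intro k
  obtain ⟨C, hC, h⟩ := exists_abs_integral_comp_cos_mul_cos_le hV hIV k hu
  refine ⟨1 / π * C, by positivity, fun n hn ↦ ?_⟩
  rw [integral_mul_chebT, abs_mul, abs_of_pos (by positivity : 0 < 1 / π), mul_div_assoc]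
  gcongr
  exact h n hn
end

section
/- Let u : ℝ → ℝ be continuously differentiable on a neighborhood of [−1,1]. Then for every n ∈ ℕ: (1/π)·∫_{−1}^{1} u'(x)·Uₙ(x)·√(1−x²) dx = (n+1)·(1/π)·∫_{−1}^{1} u(x)·T_{n+1}(x)·(1−x²)^{−1/2} dx. (This is the duality identity ⟨∂ₓu, Uₙ⟩_ω = −⟨u, ω∂ₓω Uₙ⟩_{1/ω} = (n+1)·⟨u, T_{n+1}⟩_{1/ω}, by which ∂ₓ extends to a continuous map T^{s+1} → U^s.) -/
open MeasureTheory Real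

/-- The degree-`n` Chebyshev polynomial of the second kind, as a function `ℝ → ℝ`. -/
noncomputable def chebU (n : ℕ) (x : ℝ) : ℝ :=
  (Polynomial.Chebyshev.U ℝ (n : ℤ)).eval x

theorem chebU_mul_sqrt_eq_sin (n : ℕ) {x : ℝ} (hx : x ∈ Set.Icc (-1 : ℝ) 1) :
    chebU n x * √(1 - x ^ 2) = sin ((n + 1) * arccos x) := by
  have h := Polynomial.Chebyshev.U_real_cos (arccos x) n
  rw [cos_arccos hx.1 hx.2, sin_arccos] at h
  simpa [chebU] using h

theorem chebT_eq_cos (n : ℕ) {x : ℝ} (hx : x ∈ Set.Icc (-1 : ℝ) 1) :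
    chebT n x = cos (n * arccos x) := by
  have h := Polynomial.Chebyshev.T_real_cos (arccos x) n
  rw [cos_arccos hx.1 hx.2] at h
  simpa [chebT] using h

theorem continuous_chebT (n : ℕ) : Continuous (chebT n) :=
  (Polynomial.Chebyshev.T ℝ (n : ℤ)).continuous

theorem continuous_chebU (n : ℕ) : Continuous (chebU n) :=
  (Polynomial.Chebyshev.U ℝ (n : ℤ)).continuous

theorem hasDerivAt_chebU_mul_sqrt (n : ℕ) {x : ℝ} (hx : x ∈ Set.Ioo (-1 : ℝ) 1) :
    HasDerivAt (fun y => chebU n y * √(1 - y ^ 2))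
      (-(n + 1) * (chebT (n + 1) x * (√(1 - x ^ 2))⁻¹)) x := by
  have hsin := ((hasDerivAt_arccos hx.1.ne' hx.2.ne).const_mul ((n : ℝ) + 1)).sin
  refine (hsin.congr_of_eventuallyEq ?_).congr_deriv ?_
  · filter_upwards [Icc_mem_nhds hx.1 hx.2] with y hy
    exact chebU_mul_sqrt_eq_sin n hy
  · rw [chebT_eq_cos (n + 1) (Set.Ioo_subset_Icc_self hx)]
    push_cast
    ring

/-- The duality identity `⟨∂ₓu, Uₙ⟩_ω = (n+1)·⟨u, T_{n+1}⟩_{1/ω}` for `u` of class `C¹`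
on a neighborhood of `[-1,1]`. -/
theorem stmt11 (u : ℝ → ℝ) (V : Set ℝ) (hV : IsOpen V) (hIV : Set.Icc (-1 : ℝ) 1 ⊆ V)
    (hu : ContDiffOn ℝ 1 u V) (n : ℕ) :
    (1 / π) * ∫ x in Set.Ioo (-1 : ℝ) 1, deriv u x * chebU n x * Real.sqrt (1 - x ^ 2)
      = ((n : ℝ) + 1)
        * ((1 / π) * ∫ x in Set.Ioo (-1 : ℝ) 1,
            u x * chebT (n + 1) x * (Real.sqrt (1 - x ^ 2))⁻¹) := by
  have hI : Set.uIcc (-1 : ℝ) 1 = Set.Icc (-1) 1 := Set.uIcc_of_le (by norm_num)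
  have hcont : ContinuousOn u (Set.uIcc (-1) 1) := hI ▸ hu.continuousOn.mono hIV
  have hderiv : ContinuousOn (deriv u) (Set.uIcc (-1) 1) :=
    hI ▸ (hu.continuousOn_deriv_of_isOpen hV le_rfl).mono hIV
  have hint : IntervalIntegrable
      (fun x => -((n : ℝ) + 1) * (chebT (n + 1) x * (√(1 - x ^ 2))⁻¹)) volume (-1) 1 := by
    have h := Polynomial.Chebyshev.intervalIntegrable_sqrt_one_sub_sq_inv
    simp only [sqrt_inv] at h
    exact (h.continuousOn_mul (continuous_chebT (n + 1)).continuousOn).const_mul _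
  have hparts := intervalIntegral.integral_mul_deriv_eq_deriv_mul_of_hasDerivAt
    (v := fun x => chebU n x * √(1 - x ^ 2)) hcont
    (by have := continuous_chebU n; fun_prop)
    (fun x hx => ((hu.differentiableOn one_ne_zero).differentiableAt
      (hV.mem_nhds (hIV (Set.Ioo_subset_Icc_self (by simpa using hx))))).hasDerivAt)
    (fun x hx => hasDerivAt_chebU_mul_sqrt n (by simpa using hx))
    hderiv.intervalIntegrable hint
  have hfactor (x : ℝ) : u x * (-((n : ℝ) + 1) * (chebT (n + 1) x * (√(1 - x ^ 2))⁻¹)) =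
      -((n : ℝ) + 1) * (u x * chebT (n + 1) x * (√(1 - x ^ 2))⁻¹) := by ring
  simp only [hfactor, intervalIntegral.integral_const_mul, ← mul_assoc (deriv u _)] at hparts
  rw [intervalIntegral.integral_of_le (by norm_num), intervalIntegral.integral_of_le (by norm_num),
    integral_Ioc_eq_integral_Ioo, integral_Ioc_eq_integral_Ioo] at hparts
  norm_num at hparts
  linear_combination (1 / π) * hparts
end

section
/- For every x ∈ [−1,1]: −(1/(2π))·∫_{−1}^{1} ln|x−y|·(1−y²)^{−1/2} dy = (ln 2)/2, and for every integer n ≥ 1 and every x ∈ [−1,1]: −(1/(2π))·∫_{−1}^{1} ln|x−y|·Tₙ(y)·(1−y²)^{−1/2} dy = Tₙ(x)/(2n). (That is, the weighted Laplace single-layer potential S_{0,ω} on the segment satisfies S_{0,ω}T₀ = (ln 2)/2·T₀ and S_{0,ω}Tₙ = Tₙ/(2n) for n ≥ 1.) -/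
open MeasureTheory Real

open Polynomial.Chebyshev in
/-- `∫₀^π U_{2n+1}(cos t) cos t dt = π`. -/
lemma integral_U_odd_cos_mul_cos (n : ℕ) :
    ∫ t in (0 : ℝ)..π, (U ℝ (2 * n + 1 : ℤ)).eval (cos t) * cos t = π := by
  have hT (m : ℤ) (hm : m ≠ 0) : ∫ t in (0 : ℝ)..π, (T ℝ m).eval (cos t) = 0 := by
    rw [← integral_measureT_eq_integral_cos (f := fun x ↦ (T ℝ m).eval x)]
    exact integral_eval_T_real_measureT_of_ne_zero hm
  have hT_int (m : ℤ) : IntervalIntegrable (fun t ↦ (T ℝ m).eval (cos t)) volume 0 π :=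
    Continuous.intervalIntegrable (by fun_prop) _ _
  induction n with
  | zero =>
    have h (t : ℝ) : (U ℝ (2 * (0 : ℕ) + 1 : ℤ)).eval (cos t) * cos t
        = (T ℝ 2).eval (cos t) + 1 := by
      simp [T_two]; ring
    simp_rw [h]
    rw [intervalIntegral.integral_add (hT_int 2) (by simp), hT 2 (by norm_num)]
    simp
  | succ n ih =>
    have h (t : ℝ) : (U ℝ (2 * (n + 1 : ℕ) + 1 : ℤ)).eval (cos t) * cos t
        = ((T ℝ (2 * n + 4)).eval (cos t) + (T ℝ (2 * n + 2)).eval (cos t))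
          + (U ℝ (2 * n + 1 : ℤ)).eval (cos t) * cos t := by
      have h₁ := congrArg (Polynomial.eval (cos t)) (U_eq_two_mul_T_add_U ℝ (2 * n + 1))
      have h₂ := congrArg (Polynomial.eval (cos t)) (T_add_two ℝ (2 * n + 2))
      rw [show (2 * n + 2 + 2 : ℤ) = 2 * n + 4 by ring,
        show (2 * n + 2 + 1 : ℤ) = 2 * n + 1 + 2 by ring] at h₂
      rw [show (2 * (n + 1 : ℕ) + 1 : ℤ) = 2 * n + 1 + 2 by push_cast; ring]
      simp only [Polynomial.eval_add, Polynomial.eval_sub, Polynomial.eval_mul,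
        Polynomial.eval_ofNat, Polynomial.eval_X] at h₁ h₂
      rw [h₁, h₂]; ring
    simp_rw [h]
    rw [intervalIntegral.integral_add ((hT_int _).add (hT_int _))
        (Continuous.intervalIntegrable (by fun_prop) _ _),
      intervalIntegral.integral_add (hT_int _) (hT_int _), hT _ (by lia), hT _ (by lia), ih]
    simp

lemma intervalIntegrable_log_sin_mul {f : ℝ → ℝ} (hf : Continuous f) (a b : ℝ) :
    IntervalIntegrable (fun t ↦ log (sin t) * f t) volume a b :=
  intervalIntegrable_log_sin.mul_continuousOn hf.continuousOn

open Polynomial.Chebyshev in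
/-- The cosine Fourier coefficients of `log ∘ sin` on `[0, π]`. -/
lemma integral_log_sin_mul_cos (n : ℕ) (hn : n ≠ 0) :
    ∫ t in (0 : ℝ)..π, log (sin t) * cos (2 * n * t) = -(π / (2 * n)) := by
  obtain ⟨m, rfl⟩ := Nat.exists_eq_succ_of_ne_zero hn
  set u : ℝ → ℝ := fun t ↦ (U ℝ (2 * m + 1 : ℤ)).eval (cos t)
  have hu (t : ℝ) : u t * sin t = sin (2 * (m + 1 : ℕ) * t) := by
    rw [U_real_cos]; push_cast; ring_nf
  have hu_cont : Continuous u := by fun_prop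
  set F : ℝ → ℝ := fun t ↦ u t * (sin t * log (sin t)) with hF
  have hF_eq (t : ℝ) : F t = sin (2 * (m + 1 : ℕ) * t) * log (sin t) := by
    rw [← hu, hF]; ring
  have hF_cont : Continuous F := hu_cont.mul (continuous_mul_log.comp continuous_sin)
  have hF_deriv : ∀ t ∈ Set.Ioo (0 : ℝ) π, HasDerivAt F
      (2 * (m + 1 : ℕ) * (log (sin t) * cos (2 * (m + 1 : ℕ) * t)) + u t * cos t) t := by
    intro t ht
    have hs : sin t ≠ 0 := (sin_pos_of_mem_Ioo ht).ne'
    rw [funext hF_eq]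
    have h₁ : HasDerivAt (fun t ↦ sin (2 * (m + 1 : ℕ) * t))
        (cos (2 * (m + 1 : ℕ) * t) * (2 * (m + 1 : ℕ))) t := by
      simpa using ((hasDerivAt_id t).const_mul (2 * (m + 1 : ℕ) : ℝ)).sin
    refine (h₁.mul ((hasDerivAt_sin t).log hs)).congr_deriv ?_
    rw [← hu]
    field_simp
  have h_int₁ := (intervalIntegrable_log_sin_mul
    (f := fun t ↦ cos (2 * (m + 1 : ℕ) * t)) (by fun_prop) 0 π).const_mul (2 * (m + 1 : ℕ) : ℝ)
  have h_int₂ : IntervalIntegrable (fun t ↦ u t * cos t) volume 0 π :=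
    (hu_cont.mul continuous_cos).intervalIntegrable _ _
  have h := intervalIntegral.integral_eq_sub_of_hasDerivAt_of_le pi_nonneg hF_cont.continuousOn
    hF_deriv (h_int₁.add h_int₂)
  rw [intervalIntegral.integral_add h_int₁ h_int₂, intervalIntegral.integral_const_mul,
    integral_U_odd_cos_mul_cos] at h
  have h0 : F π - F 0 = 0 := by simp [hF]
  rw [h0] at h
  have hm : (0 : ℝ) < (m + 1 : ℕ) := by positivity
  simp only [Nat.succ_eq_add_one]
  field_simp
  linarith

/-- The sine Fourier coefficients of `log ∘ sin` on `[0, π]` vanish. -/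
lemma integral_log_sin_mul_sin (n : ℕ) :
    ∫ t in (0 : ℝ)..π, log (sin t) * sin (2 * n * t) = 0 := by
  have h := intervalIntegral.integral_comp_sub_left (a := 0) (b := π)
    (fun t ↦ log (sin t) * sin (2 * n * t)) π
  have h' (t : ℝ) : log (sin (π - t)) * sin (2 * n * (π - t))
      = -(log (sin t) * sin (2 * n * t)) := by
    rw [sin_pi_sub, show 2 * n * (π - t) = n * (2 * π) - 2 * n * t by ring,
      sin_nat_mul_two_pi_sub]
    ring
  simp only [h', intervalIntegral.integral_neg, sub_self, sub_zero] at h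
  linarith

/-- Translating `log ∘ sin` acts on its cosine Fourier coefficients by `cos (n φ)`. -/
lemma integral_log_sin_half_sub_mul_cos (n : ℕ) (φ : ℝ) :
    ∫ θ in (-π)..π, log (sin ((θ - φ) / 2)) * cos (n * θ)
      = 2 * cos (n * φ) * ∫ t in (0 : ℝ)..π, log (sin t) * cos (2 * n * t) := by
  set g : ℝ → ℝ := fun t ↦ log (sin t) * cos (2 * n * t + n * φ) with hg
  have hg_per : Function.Periodic g π := by
    intro t
    simp only [hg]
    rw [sin_add_pi, log_neg_eq_log,
      show 2 * n * (t + π) + n * φ = 2 * n * t + n * φ + n * (2 * π) by ring,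
      cos_add_nat_mul_two_pi]
  have h₁ (θ : ℝ) : log (sin ((θ - φ) / 2)) * cos (n * θ) = g (θ / 2 - φ / 2) := by
    simp only [hg]
    congr 2 <;> ring_nf
  simp_rw [h₁]
  rw [intervalIntegral.integral_comp_div_sub g two_ne_zero (φ / 2),
    show π / 2 - φ / 2 = (-π / 2 - φ / 2) + π by ring,
    hg_per.intervalIntegral_add_eq _ 0, zero_add]
  have h₂ (t : ℝ) : g t = cos (n * φ) * (log (sin t) * cos (2 * n * t))
      - sin (n * φ) * (log (sin t) * sin (2 * n * t)) := by
    simp only [hg, cos_add]; ring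
  simp_rw [h₂]
  rw [intervalIntegral.integral_sub
      ((intervalIntegrable_log_sin_mul (by fun_prop) _ _).const_mul _)
      ((intervalIntegrable_log_sin_mul (by fun_prop) _ _).const_mul _),
    intervalIntegral.integral_const_mul, intervalIntegral.integral_const_mul,
    integral_log_sin_mul_sin, smul_eq_mul]
  ring

lemma log_abs_cos_sub_cos {φ θ : ℝ} (h : cos θ ≠ cos φ) :
    log |cos φ - cos θ| = log 2 + log (sin ((θ + φ) / 2)) + log (sin ((θ - φ) / 2)) := by
  have h' : cos φ - cos θ = 2 * sin ((θ + φ) / 2) * sin ((θ - φ) / 2) := by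
    rw [cos_sub_cos, add_comm φ θ, show (φ - θ) / 2 = -((θ - φ) / 2) by ring, sin_neg]; ring
  have h0 : 2 * sin ((θ + φ) / 2) * sin ((θ - φ) / 2) ≠ 0 := h' ▸ sub_ne_zero.2 h.symm
  have h1 := left_ne_zero_of_mul h0
  rw [log_abs, h', log_mul h1 (right_ne_zero_of_mul h0),
    log_mul two_ne_zero (right_ne_zero_of_mul h1)]

lemma integral_log_abs_cos_sub_cos_mul_cos (n : ℕ) {φ : ℝ} (hφ : φ ∈ Set.Icc 0 π) :
    ∫ θ in (0 : ℝ)..π, log |cos φ - cos θ| * cos (n * θ)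
      = log 2 * (∫ θ in (0 : ℝ)..π, cos (n * θ))
        + 2 * cos (n * φ) * ∫ t in (0 : ℝ)..π, log (sin t) * cos (2 * n * t) := by
  set k : ℝ → ℝ := fun θ ↦ log (sin ((θ - φ) / 2)) * cos (n * θ) with hk
  have hk_int (a b : ℝ) : IntervalIntegrable k volume a b := by
    have h : AnalyticOnNhd ℝ (fun θ ↦ sin ((θ - φ) / 2)) Set.univ := fun θ _ ↦ by fun_prop
    exact (h.meromorphicOn.mono_set (Set.subset_univ _)).intervalIntegrable_log.mul_continuousOn
      (by fun_prop)
  have h_ae : ∫ θ in (0 : ℝ)..π, log |cos φ - cos θ| * cos (n * θ)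
      = ∫ θ in (0 : ℝ)..π, (log 2 * cos (n * θ) + (k (-θ) + k θ)) := by
    apply intervalIntegral.integral_congr_ae
    filter_upwards [compl_mem_ae_iff.2 (measure_singleton (μ := volume) φ)] with θ hθ hmem
    rw [Set.uIoc_of_le pi_nonneg] at hmem
    have hne : cos θ ≠ cos φ := fun h ↦ hθ (injOn_cos ⟨hmem.1.le, hmem.2⟩ hφ h)
    have h_neg : k (-θ) = log (sin ((θ + φ) / 2)) * cos (n * θ) := by
      simp only [hk]
      rw [show (-θ - φ) / 2 = -((θ + φ) / 2) by ring, sin_neg, log_neg_eq_log, mul_neg, cos_neg]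
    rw [log_abs_cos_sub_cos hne, h_neg]
    simp only [hk]
    ring
  have hk_neg : IntervalIntegrable (fun θ ↦ k (-θ)) volume 0 π := by
    simpa using (hk_int 0 (-π)).comp_sub_left 0
  rw [h_ae, intervalIntegral.integral_add (Continuous.intervalIntegrable (by fun_prop) _ _)
      (hk_neg.add (hk_int _ _)), intervalIntegral.integral_add hk_neg (hk_int _ _),
    intervalIntegral.integral_comp_neg, neg_zero,
    intervalIntegral.integral_add_adjacent_intervals (hk_int _ _) (hk_int _ _),
    intervalIntegral.integral_const_mul, integral_log_sin_half_sub_mul_cos]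

open Polynomial.Chebyshev in
lemma setIntegral_mul_inv_sqrt_eq_integral_cos (f : ℝ → ℝ) :
    ∫ y in Set.Ioo (-1 : ℝ) 1, f y * (Real.sqrt (1 - y ^ 2))⁻¹
      = ∫ θ in (0 : ℝ)..π, f (cos θ) := by
  rw [← integral_measureT_eq_integral_cos, integral_measureT,
    intervalIntegral.integral_of_le (by norm_num), integral_Ioc_eq_integral_Ioo]
  simp only [Real.sqrt_inv]

/-- Spectral identities for the weighted Laplace single-layer potential on the segment:
`S_{0,ω} T₀ = (ln 2)/2` and `S_{0,ω} Tₙ = Tₙ/(2n)` for `n ≥ 1`. -/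
theorem stmt12 :
    (∀ x ∈ Set.Icc (-1 : ℝ) 1,
        -(1 / (2 * π)) * ∫ y in Set.Ioo (-1 : ℝ) 1,
            Real.log |x - y| * (Real.sqrt (1 - y ^ 2))⁻¹ = Real.log 2 / 2) ∧
      ∀ n : ℕ, 1 ≤ n → ∀ x ∈ Set.Icc (-1 : ℝ) 1,
        -(1 / (2 * π)) * ∫ y in Set.Ioo (-1 : ℝ) 1,
            Real.log |x - y| * chebT n y * (Real.sqrt (1 - y ^ 2))⁻¹
          = chebT n x / (2 * n) := by
  refine ⟨fun x hx ↦ ?_, fun n hn x hx ↦ ?_⟩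
  · have h := integral_log_abs_cos_sub_cos_mul_cos 0 ⟨arccos_nonneg x, arccos_le_pi x⟩
    simp only [cos_arccos hx.1 hx.2, Nat.cast_zero, mul_zero, zero_mul, cos_zero, mul_one,
      integral_log_sin_zero_pi, intervalIntegral.integral_const, smul_eq_mul, sub_zero] at h
    rw [setIntegral_mul_inv_sqrt_eq_integral_cos (fun y ↦ log |x - y|), h]
    field_simp
    ring
  · have hn0 : n ≠ 0 := by lia
    have hT (θ : ℝ) : chebT n (cos θ) = cos (n * θ) := by
      simp [chebT, Polynomial.Chebyshev.T_real_cos]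
    have hcos : ∫ θ in (0 : ℝ)..π, cos (n * θ) = 0 := by
      rw [intervalIntegral.integral_comp_mul_left _ (by exact_mod_cast hn0)]
      simp
    have h := integral_log_abs_cos_sub_cos_mul_cos n ⟨arccos_nonneg x, arccos_le_pi x⟩
    rw [hcos, integral_log_sin_mul_cos n hn0, ← hT, cos_arccos hx.1 hx.2] at h
    rw [setIntegral_mul_inv_sqrt_eq_integral_cos (fun y ↦ log |x - y| * chebT n y)]
    simp only [hT]
    rw [h]
    have hn0' : (n : ℝ) ≠ 0 := by exact_mod_cast hn0
    field_simp
    ring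
end
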